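/- arXiv:0903.4456 — 2 statements merged into one kernel-verified Lean document; each statement's English description precedes it below -/
import Mathlib

section
/- Let $R$ be a field of characteristic zero and $X$ a type. The canonical $R$-linear map from the free $R$-module on $X$ to the abelianization of the free Lie algebra, $\mathrm{FreeLieAlgebra}\,R\,X \,/\, [\mathrm{FreeLieAlgebra}\,R\,X, \mathrm{FreeLieAlgebra}\,R\,X]$, induced by sending each basis element $x$ to the class of the generator $\iota(x)$, is a linear isomorphism. (This is the statement $H_1(L(U),\mathbb{C}) = U \cong L(U)/[L(U),L(U)]$ for the free Lie algebra $L(U)$ on a vector space $U$.) -/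
namespace FreeLieAlgebra

variable (R X : Type*) [CommRing R]

/-- The free module on `X`, regarded as an abelian Lie ring. -/
noncomputable abbrev finsuppLieRing : LieRing (X →₀ R) where
  bracket _ _ := 0
  add_lie _ _ _ := (add_zero 0).symm
  lie_add _ _ _ := (add_zero 0).symm
  lie_self _ := rfl
  leibniz_lie _ _ _ := (add_zero 0).symm

/-- The free module on `X`, regarded as an abelian Lie algebra. -/
noncomputable abbrev finsuppLieAlgebra :
    letI := finsuppLieRing R X
    LieAlgebra R (X →₀ R) :=
  letI := finsuppLieRing R X
  { lie_smul := fun t _ _ => (smul_zero t).symm }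

/-- The linear part map on the free Lie algebra: it fixes the generators and kills brackets. -/
theorem exists_linearPart :
    ∃ f : FreeLieAlgebra R X →ₗ[R] X →₀ R,
      (∀ x, f (of R x) = Finsupp.single x 1) ∧
        ∀ a b : FreeLieAlgebra R X, f ⁅a, b⁆ = 0 := by
  let := finsuppLieRing R X
  let := finsuppLieAlgebra R X
  let F : FreeLieAlgebra R X →ₗ⁅R⁆ (X →₀ R) := lift R fun x => Finsupp.single x 1
  exact ⟨F, fun x => lift_of_apply _ x, fun a b => F.map_lie a b⟩

/-- The abelianization of the free Lie algebra on `X` is the free module on `X`. -/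
theorem bijective_linearCombination_mk' :
    Function.Bijective
      (Finsupp.linearCombination R fun x : X =>
        LieSubmodule.Quotient.mk'
          ⁅(⊤ : LieIdeal R (FreeLieAlgebra R X)), (⊤ : LieIdeal R (FreeLieAlgebra R X))⁆
          (of R x)) := by
  obtain ⟨f, hof, hlie⟩ := exists_linearPart R X
  set I : LieIdeal R (FreeLieAlgebra R X) :=
    ⁅(⊤ : LieIdeal R (FreeLieAlgebra R X)), (⊤ : LieIdeal R (FreeLieAlgebra R X))⁆ with hI
  set g := Finsupp.linearCombination R fun x : X => LieSubmodule.Quotient.mk' I (of R x) with hg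
  have hmk (a b : FreeLieAlgebra R X) : LieSubmodule.Quotient.mk' I ⁅a, b⁆ = 0 :=
    (LieSubmodule.Quotient.mk_eq_zero I).2
      (LieSubmodule.lie_mem_lie (LieSubmodule.mem_top a) (LieSubmodule.mem_top b))
  have hfI : I.toSubmodule ≤ LinearMap.ker f := by
    rw [hI, LieSubmodule.lieIdeal_oper_eq_linear_span', Submodule.span_le]
    rintro _ ⟨a, -, b, -, rfl⟩
    exact hlie a b
  constructor
  · refine Function.LeftInverse.injective (g := I.toSubmodule.liftQ f hfI) fun v => ?_
    have h : (I.toSubmodule.liftQ f hfI).comp g = LinearMap.id := by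
      ext1 x
      ext1
      simp only [hg, LinearMap.comp_apply, Finsupp.lsingle_apply,
        Finsupp.linearCombination_single, one_smul, LinearMap.id_apply]
      exact hof x
    exact LinearMap.congr_fun h v
  · have hbracket (a b : FreeLieAlgebra R X ⧸ I) : ⁅a, b⁆ = 0 := by
      obtain ⟨a, rfl⟩ := LieSubmodule.Quotient.surjective_mk' I a
      obtain ⟨b, rfl⟩ := LieSubmodule.Quotient.surjective_mk' I b
      exact (LieSubmodule.Quotient.mk_bracket I a b).symm.trans (hmk a b)
    let p : FreeLieAlgebra R X →ₗ⁅R⁆ FreeLieAlgebra R X ⧸ I :=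
      { (LieSubmodule.Quotient.mk' I : FreeLieAlgebra R X →ₗ[R] FreeLieAlgebra R X ⧸ I) with
        map_lie' := fun {a b} => (hmk a b).trans (hbracket _ _).symm }
    let q : FreeLieAlgebra R X →ₗ⁅R⁆ FreeLieAlgebra R X ⧸ I :=
      { g.comp f with
        map_lie' := fun {a b} =>
          ((congrArg g (hlie a b)).trans (map_zero g)).trans (hbracket _ _).symm }
    have hqp : q = p := hom_ext fun x => by
      change g (f (of R x)) = LieSubmodule.Quotient.mk' I (of R x)
      rw [hof, hg, Finsupp.linearCombination_single, one_smul]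
    intro y
    obtain ⟨a, rfl⟩ := LieSubmodule.Quotient.surjective_mk' I y
    exact ⟨f a, LieHom.congr_fun hqp a⟩

end FreeLieAlgebra


/-- **H₁ of a free Lie algebra.**
For a field `R` of characteristic zero and a type `X`, the canonical `R`-linear map from the
free `R`-module on `X` to the abelianization
`FreeLieAlgebra R X ⧸ ⁅⊤, ⊤⁆` of the free Lie algebra, sending each basis vector `x`
to the class of the generator `FreeLieAlgebra.of R x`, is a linear isomorphism
(i.e. it is bijective).  This is the statement
`H₁(L(U), ℂ) = U ≅ L(U)/[L(U), L(U)]`. -/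
theorem freeLieAlgebra_abelianization_iso (R X : Type*) [Field R] [CharZero R] :
    Function.Bijective
      (Finsupp.linearCombination R
        (fun x : X =>
          LieSubmodule.Quotient.mk'
            (⁅(⊤ : LieIdeal R (FreeLieAlgebra R X)), (⊤ : LieIdeal R (FreeLieAlgebra R X))⁆)
            (FreeLieAlgebra.of R x)) :
        (X →₀ R) →ₗ[R]
          FreeLieAlgebra R X ⧸
            ⁅(⊤ : LieIdeal R (FreeLieAlgebra R X)), (⊤ : LieIdeal R (FreeLieAlgebra R X))⁆) := by
  exact FreeLieAlgebra.bijective_linearCombination_mk' R X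
end

section
/- Let $k$ be a field and $U$ a $k$-vector space. The $k$-linear multiplication map $\mu : T(U) \otimes_k U \to T(U)$ sending $x \otimes u$ to $x \cdot \iota(u)$, where $T(U)$ is the tensor algebra of $U$ and $\iota : U \to T(U)$ is the canonical inclusion, is injective. -/
open TensorProduct

namespace TensorAlgebra

variable (R M : Type*) [CommSemiring R] [AddCommMonoid M] [Module R M]

/-- The action of generators making `R × (T(M) ⊗ M)` a left `T(M)`-module which extends the
trivial module `R` by the free module `T(M) ⊗ M`: it sends `(c, z)` to `(0, ι m • z + c • 1 ⊗ m)`. -/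
noncomputable def extensionAction :
    M →ₗ[R] Module.End R (R × (TensorAlgebra R M ⊗[R] M)) :=
  LinearMap.mk₂ R (fun m p ↦ (0, ι R m • p.2 + p.1 • (1 ⊗ₜ[R] m)))
    (fun m n p ↦ by ext <;> simp [add_smul, tmul_add, add_add_add_comm])
    (fun c m p ↦ by ext <;> simp [smul_comm c p.1])
    (fun m p q ↦ by ext <;> simp [add_smul, add_add_add_comm])
    (fun c m p ↦ by ext <;> simp [smul_comm c (ι R m), mul_smul])

variable {R M}

lemma extensionAction_apply (m : M) (p : R × (TensorAlgebra R M ⊗[R] M)) :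
    extensionAction R M m p = (0, ι R m • p.2 + p.1 • (1 ⊗ₜ[R] m)) := rfl

lemma lift_extensionAction_inr (x : TensorAlgebra R M) (z : TensorAlgebra R M ⊗[R] M) :
    lift R (extensionAction R M) x (0, z) = (0, x • z) := by
  induction x using TensorAlgebra.induction generalizing z with
  | algebraMap r => simp [Module.algebraMap_end_apply, algebraMap_smul]
  | ι m => simp [extensionAction_apply]
  | mul a b ha hb => simp [ha, hb, mul_smul]
  | add a b ha hb => simp [ha, hb, add_smul]

lemma lift_extensionAction_mul_ι (x : TensorAlgebra R M) (m : M) :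
    lift R (extensionAction R M) (x * ι R m) (1, 0) = (0, x ⊗ₜ[R] m) := by
  simp [extensionAction_apply, lift_extensionAction_inr, smul_tmul']

end TensorAlgebra

/-- **Injectivity of the multiplication map in the free resolution.**
Let `k` be a field and `U` a `k`-vector space.  The `k`-linear multiplication map
`μ : T(U) ⊗ₖ U → T(U)`, determined by `x ⊗ u ↦ x * ι u`, where `T(U)` is the tensor
algebra of `U` and `ι : U → T(U)` is the canonical inclusion, is injective. -/
theorem tensorAlgebra_mul_injective (k U : Type*) [Field k] [AddCommGroup U] [Module k U]
    (μ : TensorProduct k (TensorAlgebra k U) U →ₗ[k] TensorAlgebra k U)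
    (hμ : ∀ (x : TensorAlgebra k U) (u : U), μ (x ⊗ₜ[k] u) = x * TensorAlgebra.ι k u) :
    Function.Injective μ := by
  refine Function.LeftInverse.injective
    (g := fun x ↦ (TensorAlgebra.lift k (TensorAlgebra.extensionAction k U) x (1, 0)).2) fun z ↦ ?_
  induction z with
  | zero => simp
  | tmul x u => simp only [hμ, TensorAlgebra.lift_extensionAction_mul_ι]
  | add a b ha hb => simpa using congrArg₂ (· + ·) ha hb
end
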